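/- Let (Γ; ≤₁, …, ≤ₙ) be a homogeneous n-dimensional permutation structure with lattice Λ of ∅-definable equivalence relations, and for x, y ∈ Γ let d(x,y) ∈ Λ denote the intersection of all ∅-definable equivalence relations relating x and y. Then the reduct of Γ to the language of ∅-definable equivalence relations is the generic Λ-ultrametric space; concretely, (Γ, d) satisfies the one-point extension property: for every finite A ⊆ Γ and every function f : A → Λ such that for all a, b ∈ A, f(a) ≤ f(b) ⊔ d(a,b) and d(a,b) ≤ f(a) ⊔ f(b) (where ≤ is refinement and ⊔ is the join in Λ), there exists x ∈ Γ with d(x,a) = f(a) for all a ∈ A. -/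

import Mathlib

/-- An `n`-dimensional permutation structure: a set `Γ` equipped with `n` linear orders. -/
structure PermStruct (n : ℕ) (Γ : Type*) where
  le : Fin n → Γ → Γ → Prop
  total : ∀ i x y, le i x y ∨ le i y x
  antisymm : ∀ i x y, le i x y → le i y x → x = y
  trans : ∀ i x y z, le i x y → le i y z → le i x z

namespace PermStruct

variable {n : ℕ} {Γ : Type*} (S : PermStruct n Γ)

/-- An automorphism of the permutation structure: a bijection of `Γ` preserving each order. -/
def IsAuto (σ : Γ ≃ Γ) : Prop :=
  ∀ i x y, S.le i x y ↔ S.le i (σ x) (σ y)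

/-- Homogeneity: every isomorphism between finite substructures (i.e. every bijection between
finite subsets preserving each order) extends to an automorphism. -/
def Homogeneous : Prop :=
  ∀ (A : Finset Γ) (f : Γ → Γ), Set.InjOn f A →
    (∀ i, ∀ x ∈ A, ∀ y ∈ A, (S.le i x y ↔ S.le i (f x) (f y))) →
    ∃ σ : Γ ≃ Γ, S.IsAuto σ ∧ ∀ a ∈ A, σ a = f a

/-- A binary relation is ∅-definable iff it is invariant under all automorphisms. -/
def Definable (R : Γ → Γ → Prop) : Prop :=
  ∀ σ : Γ ≃ Γ, S.IsAuto σ → ∀ x y, R x y ↔ R (σ x) (σ y)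

/-- `E` is `≤ᵢ`-convex: every `E`-class is an interval with respect to `≤ᵢ`. -/
def Convex (i : Fin n) (E : Γ → Γ → Prop) : Prop :=
  ∀ x y z, S.le i x y → S.le i y z → E x z → E x y

end PermStruct

/-- `S.dmin x y` is the intersection of all ∅-definable equivalence relations relating `x`
and `y`: the distance `d(x,y)` in the lattice of ∅-definable equivalence relations. -/
def PermStruct.dmin {n : ℕ} {Γ : Type*} (S : PermStruct n Γ) (x y : Γ) : Γ → Γ → Prop :=
  fun u v => ∀ R : Γ → Γ → Prop, S.Definable R → Equivalence R → R x y → R u v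

theorem Setoid.sup_rel_of_transGen {α : Type*} {E F : Setoid α} {u v : α}
    (h : Relation.TransGen (fun p q => E p q ∨ F p q) u v) : (E ⊔ F) u v := by
  have hstep : ∀ {p q}, E p q ∨ F p q → (E ⊔ F) p q := fun h =>
    h.elim (le_sup_left (a := E) (b := F) ·) (le_sup_right (a := E) (b := F) ·)
  induction h with
  | single h => exact hstep h
  | tail _ h ih => exact (E ⊔ F).trans' ih (hstep h)

/-- In a modular lattice, a failure of distributivity yields three elements with pairwise equal
meets, the first of which lies below the join of the two others but not below the second. -/
theorem IsModularLattice.exists_inf_eq_of_not_distrib {α : Type*} [Lattice α] [IsModularLattice α]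
    {a b c : α} (h : ¬ a ⊓ (b ⊔ c) ≤ (a ⊓ b) ⊔ (a ⊓ c)) :
    ∃ e f k : α, e ⊓ f = f ⊓ k ∧ e ⊓ k = f ⊓ k ∧ e ≤ f ⊔ k ∧ ¬ e ≤ f := by
  set m := (a ⊓ b) ⊔ (a ⊓ c) with hm
  set d := a ⊓ (b ⊔ c) with hd
  have hmd : m ≤ d :=
    sup_le (inf_le_inf_left a le_sup_left) (inf_le_inf_left a le_sup_right)
  have hdf : d ⊓ (b ⊔ m) ≤ m := by
    refine (inf_sup_le_assoc_of_le b hmd).trans ?_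
    exact sup_le ((inf_le_inf_right b inf_le_left).trans le_sup_left) le_rfl
  have hdk : d ⊓ (c ⊔ m) ≤ m := by
    refine (inf_sup_le_assoc_of_le c hmd).trans ?_
    exact sup_le ((inf_le_inf_right c inf_le_left).trans le_sup_right) le_rfl
  have hmp : m ≤ (b ⊔ m) ⊓ (c ⊔ m) := le_inf le_sup_right le_sup_right
  refine ⟨d ⊔ (b ⊔ m) ⊓ (c ⊔ m), b ⊔ m, c ⊔ m, ?_, ?_, ?_, fun hle => h ?_⟩
  · rw [sup_comm d, sup_inf_assoc_of_le d inf_le_left]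
    exact sup_eq_left.2 (hdf.trans hmp)
  · rw [sup_comm d, sup_inf_assoc_of_le d inf_le_right]
    exact sup_eq_left.2 (hdk.trans hmp)
  · refine sup_le (inf_le_right.trans ?_) (inf_le_left.trans le_sup_left)
    exact sup_le_sup le_sup_left le_sup_left
  · exact (le_inf le_rfl (le_sup_left.trans hle)).trans hdf

theorem Finset.inf_setoid_iff {ι α : Type*} (s : Finset ι) (E : ι → Setoid α) (x y : α) :
    s.inf E x y ↔ ∀ i ∈ s, E i x y := by
  classical
  induction s using Finset.induction_on with
  | empty => exact iff_of_true trivial (by simp)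
  | insert i s _ ih => rw [Finset.inf_insert, Setoid.inf_iff_and, ih, Finset.forall_mem_insert]

theorem Nat.exists_sq_pow_lt_two_pow (n : ℕ) : ∃ N : ℕ, ((N + 2) ^ 2) ^ n < 2 ^ N := by
  have key : 4 * n ^ 2 + 10 * n + 8 < 32 * 4 ^ n := by
    induction n with
    | zero => norm_num
    | succ n ih => rw [pow_succ 4 n]; nlinarith
  have hk : 2 ^ (2 * n + 5) = 32 * 4 ^ n := by
    rw [pow_add, pow_mul]; norm_num [mul_comm]
  refine ⟨2 ^ (2 * n + 5) - 2, ?_⟩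
  rw [Nat.sub_add_cancel (by omega), ← pow_mul, ← pow_mul]
  refine Nat.pow_lt_pow_right one_lt_two ?_
  have : (2 * n + 5) * (2 * n) = 4 * n ^ 2 + 10 * n := by ring
  omega

namespace PermStruct

variable {n : ℕ} {Γ : Type*} {S : PermStruct n Γ}

theorem le_refl (S : PermStruct n Γ) (i : Fin n) (x : Γ) : S.le i x x :=
  (S.total i x x).elim id id

theorem IsAuto.one : S.IsAuto 1 := fun _ _ _ => Iff.rfl

theorem IsAuto.mul {σ τ : Equiv.Perm Γ} (hσ : S.IsAuto σ) (hτ : S.IsAuto τ) : S.IsAuto (σ * τ) :=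
  fun i x y => (hτ i x y).trans (hσ i (τ x) (τ y))

theorem IsAuto.inv {σ : Equiv.Perm Γ} (hσ : S.IsAuto σ) : S.IsAuto σ⁻¹ := fun i x y => by
  simpa using (hσ i (σ⁻¹ x) (σ⁻¹ y)).symm

theorem Homogeneous.exists_auto_apply_eq (hhom : S.Homogeneous) (x y : Γ) :
    ∃ σ : Equiv.Perm Γ, S.IsAuto σ ∧ σ x = y := by
  obtain ⟨σ, hσ, h⟩ := hhom {x} (fun _ => y) (by simp) (by simp [S.le_refl])
  exact ⟨σ, hσ, h x (by simp)⟩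

/-- Two points with the same position over a finite set are conjugate by an automorphism fixing
that set pointwise. -/
theorem Homogeneous.exists_auto_fixing [NeZero n] (hhom : S.Homogeneous) (B : Finset Γ) {z z' : Γ}
    (h : ∀ b ∈ B, ∀ i, (S.le i b z ↔ S.le i b z') ∧ (S.le i z b ↔ S.le i z' b)) :
    ∃ τ : Equiv.Perm Γ, S.IsAuto τ ∧ (∀ b ∈ B, τ b = b) ∧ τ z = z' := by
  classical
  by_cases hz : z = z'
  · exact ⟨1, .one, fun _ _ => rfl, hz⟩
  have hzB : z ∉ B := fun hB => hz <| S.antisymm 0 _ _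
    (((h z hB 0).1).1 (S.le_refl _ _)) (((h z hB 0).2).1 (S.le_refl _ _))
  have hzB' : z' ∉ B := fun hB => hz <| S.antisymm 0 _ _
    (((h z' hB 0).2).2 (S.le_refl _ _)) (((h z' hB 0).1).2 (S.le_refl _ _))
  have hne : ∀ b ∈ B, b ≠ z := fun b hb hbz => hzB (hbz ▸ hb)
  have hne' : ∀ b ∈ B, b ≠ z' := fun b hb hbz => hzB' (hbz ▸ hb)
  have hfB : ∀ b ∈ B, Function.update id z z' b = b := fun b hb => by
    simp [Function.update_of_ne (hne b hb)]
  have hfz : Function.update id z z' z = z' := by simp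
  refine Exists.elim (hhom (insert z B) (Function.update id z z') ?_ ?_) fun τ ⟨hτ, hτf⟩ => ?_
  · intro x hx y hy hxy
    simp only [Finset.coe_insert, Set.mem_insert_iff, Finset.mem_coe] at hx hy
    rcases hx with rfl | hx <;> rcases hy with rfl | hy
    · rfl
    · rw [hfz, hfB y hy] at hxy; exact absurd hxy.symm (hne' y hy)
    · rw [hfz, hfB x hx] at hxy; exact absurd hxy (hne' x hx)
    · rwa [hfB x hx, hfB y hy] at hxy
  · intro i x hx y hy
    rw [Finset.mem_insert] at hx hy
    rcases hx with rfl | hx <;> rcases hy with rfl | hy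
    · simp [S.le_refl]
    · rw [hfz, hfB y hy]; exact (h y hy i).2
    · rw [hfz, hfB x hx]; exact (h x hx i).1
    · rw [hfB x hx, hfB y hy]
  · exact ⟨τ, hτ, fun b hb => (hτf b (by simp [hb])).trans (hfB b hb),
      (hτf z (by simp)).trans hfz⟩

/-- A sequence is indiscernible if any two increasing finite subsequences of the same length are
conjugate under automorphisms. -/
def Indiscernible (S : PermStruct n Γ) (a : ℕ → Γ) : Prop :=
  ∀ h : ℕ → ℕ, StrictMono h → ∀ N : ℕ,
    ∃ τ : Equiv.Perm Γ, S.IsAuto τ ∧ ∀ j ≤ N, τ (a j) = a (h j)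

theorem Homogeneous.indiscernible_of_le_iff (hhom : S.Homogeneous) {a : ℕ → Γ}
    (hinj : Function.Injective a)
    (hle : ∀ i p q, p < q → (S.le i (a p) (a q) ↔ S.le i (a 0) (a 1))) : S.Indiscernible a := by
  classical
  intro h hh N
  have hf : ∀ j, (a ∘ h ∘ Function.invFun a) (a j) = a (h j) := fun j => by
    simp [Function.leftInverse_invFun hinj j]
  have hgt : ∀ i p q, p < q → (S.le i (a q) (a p) ↔ ¬ S.le i (a 0) (a 1)) := fun i p q hpq => by
    rw [← hle i p q hpq]
    exact ⟨fun h₁ h₂ => hpq.ne (hinj (S.antisymm i _ _ h₂ h₁)), (S.total i _ _).resolve_left⟩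
  refine Exists.elim (hhom ((Finset.range (N + 1)).image a) (a ∘ h ∘ Function.invFun a) ?_ ?_)
    fun τ ⟨hτ, hτf⟩ => ?_
  · intro x hx y hy hxy
    obtain ⟨p, -, rfl⟩ := Finset.mem_image.1 hx
    obtain ⟨q, -, rfl⟩ := Finset.mem_image.1 hy
    rw [hf, hf] at hxy
    rw [hh.injective (hinj hxy)]
  · intro i x hx y hy
    obtain ⟨p, -, rfl⟩ := Finset.mem_image.1 hx
    obtain ⟨q, -, rfl⟩ := Finset.mem_image.1 hy
    rw [hf, hf]
    rcases lt_trichotomy p q with hpq | rfl | hpq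
    · rw [hle i p q hpq, hle i _ _ (hh hpq)]
    · simp [S.le_refl]
    · rw [hgt i q p hpq, hgt i _ _ (hh hpq)]
  · exact ⟨τ, hτ, fun j hj =>
      (hτf (a j) (Finset.mem_image_of_mem a (by simpa [Nat.lt_succ_iff] using hj))).trans (hf j)⟩

theorem Homogeneous.indiscernible_iterate [NeZero n] (hhom : S.Homogeneous) {σ : Equiv.Perm Γ}
    (hσ : S.IsAuto σ) {x : Γ} (hx : σ x ≠ x) : S.Indiscernible fun k => σ^[k] x := by
  have hstep : ∀ i k, (S.le i (σ^[k] x) (σ^[k + 1] x) ↔ S.le i x (σ x)) ∧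
      (S.le i (σ^[k + 1] x) (σ^[k] x) ↔ S.le i (σ x) x) := by
    intro i k
    induction k with
    | zero => simp
    | succ k ih =>
      rw [Function.iterate_succ_apply' σ (k + 1), Function.iterate_succ_apply' σ k,
        ← ih.1, ← ih.2, hσ i (σ^[k] x), hσ i (σ^[k + 1] x), Function.iterate_succ_apply' σ k]
      exact ⟨Iff.rfl, Iff.rfl⟩
  have hup : ∀ i, S.le i x (σ x) → ∀ p q, p ≤ q → S.le i (σ^[p] x) (σ^[q] x) := by
    intro i hi p q hpq
    induction q, hpq using Nat.le_induction with
    | base => exact S.le_refl _ _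
    | succ q _ ih => exact S.trans i _ _ _ ih ((hstep i q).1.2 hi)
  have hdown : ∀ i, S.le i (σ x) x → ∀ p q, p ≤ q → S.le i (σ^[q] x) (σ^[p] x) := by
    intro i hi p q hpq
    induction q, hpq using Nat.le_induction with
    | base => exact S.le_refl _ _
    | succ q _ ih => exact S.trans i _ _ _ ((hstep i q).2.2 hi) ih
  have hne : ∀ p q, p < q → σ^[p] x ≠ σ^[q] x := by
    intro p q hpq heq
    have hfix : σ^[p + 1] x ≠ σ^[p] x := by
      rw [Function.iterate_succ_apply]
      exact fun h => hx (σ.injective.iterate p h)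
    rcases S.total 0 x (σ x) with h | h
    · exact hfix (S.antisymm 0 _ _ (heq ▸ hup 0 h _ _ hpq) ((hstep 0 p).1.2 h))
    · exact hfix (S.antisymm 0 _ _ ((hstep 0 p).2.2 h) (heq ▸ hdown 0 h _ _ hpq))
  refine hhom.indiscernible_of_le_iff (fun p q hpq => ?_) fun i p q hpq => ⟨fun h => ?_, fun h => ?_⟩
  · rcases lt_trichotomy p q with h | h | h
    · exact absurd hpq (hne _ _ h)
    · exact h
    · exact absurd hpq.symm (hne _ _ h)
  · rcases S.total i x (σ x) with h' | h'
    · exact h'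
    · exact absurd (S.antisymm i _ _ h (hdown i h' p q hpq.le)) (hne p q hpq)
  · exact hup i h p q hpq.le

/-- Since every nontrivial 2-type is a strict partial order, a definable relation between `x` and
`σ x` also holds between `x` and every further iterate. -/
theorem Homogeneous.rel_iterate [NeZero n] (hhom : S.Homogeneous) {σ : Equiv.Perm Γ}
    (hσ : S.IsAuto σ) {R : Γ → Γ → Prop} (hR : S.Definable R) {x : Γ} {k : ℕ} (hk : 0 < k) :
    R x (σ^[k] x) ↔ R x (σ x) := by
  by_cases hx : σ x = x
  · rw [Function.iterate_fixed hx, hx]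
  obtain ⟨τ, hτ, h⟩ := hhom.indiscernible_iterate hσ hx (fun j => j * k)
    (strictMono_mul_right_of_pos hk) 1
  have h0 := h 0 zero_le_one
  have h1 := h 1 le_rfl
  simp only [Function.iterate_zero, id, zero_mul, Function.iterate_one, one_mul] at h0 h1
  rw [hR τ hτ x (σ x), h0, h1]

theorem Definable.comp {R T : Γ → Γ → Prop} (hR : S.Definable R) (hT : S.Definable T) :
    S.Definable fun x z => ∃ y, R x y ∧ T y z := fun σ hσ x z => by
  constructor
  · rintro ⟨y, h₁, h₂⟩
    exact ⟨σ y, (hR σ hσ _ _).1 h₁, (hT σ hσ _ _).1 h₂⟩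
  · rintro ⟨y, h₁, h₂⟩
    refine ⟨σ.symm y, (hR σ hσ _ _).2 ?_, (hT σ hσ _ _).2 ?_⟩ <;> simpa

theorem Definable.inf {E F : Setoid Γ} (hE : S.Definable E) (hF : S.Definable F) :
    S.Definable (E ⊓ F : Setoid Γ) := fun σ hσ x y =>
  and_congr (hE σ hσ x y) (hF σ hσ x y)

theorem Definable.finset_inf {ι : Type*} {s : Finset ι} {E : ι → Setoid Γ}
    (hE : ∀ i ∈ s, S.Definable (E i)) : S.Definable (s.inf E : Setoid Γ) := fun σ hσ x y => by
  simp only [Finset.inf_setoid_iff]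
  exact forall₂_congr fun i hi => hE i hi σ hσ x y

/-- Definable equivalence relations permute. -/
theorem Homogeneous.permute [NeZero n] (hhom : S.Homogeneous) {E F : Setoid Γ}
    (hE : S.Definable E) (hF : S.Definable F) {x y z : Γ} (hxy : E x y) (hyz : F y z) :
    ∃ w, F x w ∧ E w z := by
  obtain ⟨σ, hσ, rfl⟩ := hhom.exists_auto_apply_eq x z
  have hFE := hF.comp hE
  have hy : ∃ w, F y w ∧ E w (σ^[2] y) :=
    (hhom.rel_iterate hσ hFE two_pos).2 ⟨σ x, hyz, (hE σ hσ _ _).1 hxy⟩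
  obtain ⟨w, hyw, hw⟩ := hy
  refine (hFE σ hσ x (σ x)).2 ⟨w, F.trans' (F.symm' hyz) hyw, E.trans' hw ?_⟩
  exact E.symm' ((hE σ hσ _ _).1 ((hE σ hσ _ _).1 hxy))

theorem Homogeneous.sup_iff [NeZero n] (hhom : S.Homogeneous) {E F : Setoid Γ}
    (hE : S.Definable E) (hF : S.Definable F) {x z : Γ} :
    (E ⊔ F) x z ↔ ∃ y, E x y ∧ F y z := by
  constructor
  · let T : Setoid Γ :=
      { r := fun x z => ∃ y, E x y ∧ F y z
        iseqv :=
          { refl := fun x => ⟨x, E.refl' x, F.refl' x⟩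
            symm := fun ⟨_, h₁, h₂⟩ => hhom.permute hF hE (F.symm' h₂) (E.symm' h₁)
            trans := fun ⟨_, h₁, h₂⟩ ⟨_, h₃, h₄⟩ =>
              let ⟨w, h₅, h₆⟩ := hhom.permute hF hE h₂ h₃
              ⟨w, E.trans' h₁ h₅, F.trans' h₆ h₄⟩ } }
    have hle : E ⊔ F ≤ T :=
      sup_le (fun _ y h => ⟨y, h, F.refl' y⟩) (fun x _ h => ⟨x, E.refl' x, h⟩)
    exact fun h => hle h
  · rintro ⟨y, h₁, h₂⟩
    exact (E ⊔ F).trans' (le_sup_left (a := E) (b := F) h₁) (le_sup_right (a := E) (b := F) h₂)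

theorem Homogeneous.definable_sup [NeZero n] (hhom : S.Homogeneous) {E F : Setoid Γ}
    (hE : S.Definable E) (hF : S.Definable F) : S.Definable (E ⊔ F : Setoid Γ) :=
  fun σ hσ x z => by
    rw [hhom.sup_iff hE hF, hhom.sup_iff hE hF]
    exact hE.comp hF σ hσ x z

/-- The lattice of definable equivalence relations of a homogeneous permutation structure. -/
def Homogeneous.definableLattice [NeZero n] (hhom : S.Homogeneous) : Sublattice (Setoid Γ) where
  carrier := {E | S.Definable E}
  supClosed' := fun _ hE _ hF => hhom.definable_sup hE hF
  infClosed' := fun _ hE _ hF => hE.inf hF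

instance Homogeneous.isModularLattice_definableLattice [NeZero n] (hhom : S.Homogeneous) :
    IsModularLattice hhom.definableLattice where
  sup_inf_le_assoc_of_le := by
    rintro ⟨E, hE⟩ ⟨F, hF⟩ ⟨K, hK⟩ (hEK : E ≤ K)
    change (E ⊔ F) ⊓ K ≤ E ⊔ F ⊓ K
    rintro x z ⟨hxz, hxz'⟩
    obtain ⟨y, hxy, hyz⟩ := (hhom.sup_iff hE hF).1 hxz
    exact (hhom.sup_iff hE (hF.inf hK)).2
      ⟨y, hxy, hyz, K.trans' (K.symm' (hEK hxy)) hxz'⟩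

/-- Given three equivalence relations `E`, `F`, `K` and a sequence `a` in a single `E`-class, the
points of that class reached from `a 0` by successive translations, one for each letter of the word.
The translation for `i` is the one that moves `a 0` to `a (i + 1)`: follow `F` up to the `E`-class
of a point `b` with `F (a 0) b` and `K b (a (i + 1))`, then come back along `K`. -/
def Word (E F K : Setoid Γ) (a : ℕ → Γ) : List ℕ → Γ → Prop
  | [], z => E (a 0) z ∧ (F ⊓ K) (a 0) z
  | i :: w, z => E (a 0) z ∧ ∃ y u b, Word E F K a w y ∧ F y u ∧ K u z ∧
      F (a 0) b ∧ K b (a (i + 1)) ∧ E b u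

section Word

variable {E F K : Setoid Γ} {a : ℕ → Γ}

theorem Word.rel {w : List ℕ} {z : Γ} (h : Word E F K a w z) : E (a 0) z := by
  cases w <;> exact h.1

theorem Word.map (hE : S.Definable E) (hF : S.Definable F) (hK : S.Definable K)
    {τ : Equiv.Perm Γ} (hτ : S.IsAuto τ) (h0 : τ (a 0) = a 0) (g : ℕ → ℕ) {w : List ℕ} {z : Γ}
    (hw : ∀ i ∈ w, τ (a (i + 1)) = a (g i + 1)) (h : Word E F K a w z) :
    Word E F K a (w.map g) (τ z) := by
  have hE' := fun x y => (hE τ hτ x y).1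
  have hF' := fun x y => (hF τ hτ x y).1
  have hK' := fun x y => (hK τ hτ x y).1
  induction w generalizing z with
  | nil =>
    obtain ⟨h₁, h₂, h₃⟩ := h
    exact ⟨h0 ▸ hE' _ _ h₁, h0 ▸ hF' _ _ h₂, h0 ▸ hK' _ _ h₃⟩
  | cons i w ih =>
    obtain ⟨h₁, y, u, b, hy, hyu, huz, hb, hba, hbu⟩ := h
    refine ⟨h0 ▸ hE' _ _ h₁, τ y, τ u, τ b, ih (fun j hj => hw j (by simp [hj])) hy,
      hF' _ _ hyu, hK' _ _ huz, h0 ▸ hF' _ _ hb, ?_, hE' _ _ hbu⟩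
    exact hw i (by simp) ▸ hK' _ _ hba

/-- Any two of three equivalence relations have the same intersection. -/
structure PairwiseInfEq (E F K : Setoid Γ) : Prop where
  left : ∀ {x y}, F x y → K x y → E x y
  middle : ∀ {x y}, E x y → K x y → F x y
  right : ∀ {x y}, E x y → F x y → K x y

theorem Word.unique (hEFK : PairwiseInfEq E F K) {w : List ℕ} {z z' : Γ} (h : Word E F K a w z)
    (h' : Word E F K a w z') : F z z' ∧ K z z' := by
  induction w generalizing z z' with
  | nil =>
    exact ⟨F.trans' (F.symm' h.2.1) h'.2.1, K.trans' (K.symm' h.2.2) h'.2.2⟩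
  | cons i w ih =>
    obtain ⟨h₁, y, u, b, hy, hyu, huz, hb, hba, hbu⟩ := h
    obtain ⟨h₁', y', u', b', hy', hyu', huz', hb', hba', hbu'⟩ := h'
    have hbb : E b b' :=
      hEFK.left (F.trans' (F.symm' hb) hb') (K.trans' hba (K.symm' hba'))
    have huu : E u u' := E.trans' (E.symm' hbu) (E.trans' hbb hbu')
    have hFu : F u u' := F.trans' (F.symm' hyu) (F.trans' (ih hy hy').1 hyu')
    have hKz : K z z' := K.trans' (K.symm' huz) (K.trans' (hEFK.right huu hFu) huz')
    exact ⟨hEFK.middle (E.trans' (E.symm' h₁) h₁') hKz, hKz⟩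

theorem Word.congr (hEFK : PairwiseInfEq E F K) {w : List ℕ} {z z' : Γ} (h : Word E F K a w z)
    (hF : F z z') (hK : K z z') : Word E F K a w z' := by
  have hE : E z z' := hEFK.left hF hK
  cases w with
  | nil => exact ⟨E.trans' h.1 hE, F.trans' h.2.1 hF, K.trans' h.2.2 hK⟩
  | cons i w =>
    obtain ⟨h₁, y, u, b, hy, hyu, huz, hb⟩ := h
    exact ⟨E.trans' h₁ hE, y, u, b, hy, hyu, K.trans' huz hK, hb⟩

theorem Word.exists_of_cons (hEFK : PairwiseInfEq E F K) {i : ℕ} {w w' : List ℕ} {z : Γ}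
    (h : Word E F K a (i :: w) z) (h' : Word E F K a (i :: w') z) :
    ∃ y, Word E F K a w y ∧ Word E F K a w' y := by
  obtain ⟨-, y, u, b, hy, hyu, huz, hb, hba, hbu⟩ := h
  obtain ⟨-, y', u', b', hy', hyu', huz', hb', hba', hbu'⟩ := h'
  have hbb : E b b' :=
    hEFK.left (F.trans' (F.symm' hb) hb') (K.trans' hba (K.symm' hba'))
  have huu : E u u' := E.trans' (E.symm' hbu) (E.trans' hbb hbu')
  have hFu : F u u' := hEFK.middle huu (K.trans' huz (K.symm' huz'))
  have hFy : F y' y := F.trans' hyu' (F.symm' (F.trans' hyu hFu))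
  have hEy : E y' y := E.trans' (E.symm' hy'.rel) hy.rel
  exact ⟨y, hy, hy'.congr hEFK hFy (hEFK.right hEy hFy)⟩

theorem Word.not_cons_of_lt (hE : S.Definable E) (hF : S.Definable F) (hK : S.Definable K)
    (hEFK : PairwiseInfEq E F K) (ha : S.Indiscernible a)
    (hne : ¬ K (a 0) (a 1)) {t : ℕ} {w w' : List ℕ} (hw : ∀ i ∈ w, i < t)
    (hw' : ∀ i ∈ w', i < t) {z : Γ} (h : Word E F K a w z) : ¬ Word E F K a (t :: w') z := by
  intro h'
  have hne' : ¬ K (a (t + 1)) (a (t + 2)) := by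
    obtain ⟨τ, hτ, hτa⟩ := ha (fun j => j + (t + 1)) (fun _ _ h => Nat.add_lt_add_right h _) 1
    have h0 := hτa 0 zero_le_one
    have h1 := hτa 1 le_rfl
    rwa [hK τ hτ, h0, h1, zero_add, show 1 + (t + 1) = t + 2 by omega] at hne
  obtain ⟨τ, hτ, hτa⟩ := ha (fun j => if j ≤ t then j else j + 1)
    (fun i j hij => by dsimp only; split_ifs <;> omega) (t + 1)
  have h0 : τ (a 0) = a 0 := by simpa using hτa 0 (Nat.zero_le _)
  have hlt : ∀ i < t, τ (a (i + 1)) = a (i + 1) := fun i hi => by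
    simpa [Nat.succ_le_of_lt hi] using hτa (i + 1) (by omega)
  have ht : τ (a (t + 1)) = a (t + 1 + 1) := by simpa using hτa (t + 1) le_rfl
  have hz : Word E F K a w (τ z) := by
    simpa using h.map hE hF hK hτ h0 id fun i hi => hlt i (hw i hi)
  have hz' : Word E F K a ((t + 1) :: w') (τ z) := by
    have := h'.map hE hF hK hτ h0 (fun i => if i = t then t + 1 else i) (fun i hi => by
      rcases List.mem_cons.1 hi with rfl | hi
      · simpa using ht
      · simpa [(hw' i hi).ne] using hlt i (hw' i hi))
    have hmap : w'.map (fun i => if i = t then t + 1 else i) = w' :=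
      (List.map_congr_left (g := id) fun i hi => if_neg (hw' i hi).ne).trans (List.map_id _)
    rwa [List.map_cons, if_pos rfl, hmap] at this
  obtain ⟨hFz, hKz⟩ := h.unique hEFK hz
  obtain ⟨-, y, u, b, hy, hyu, huz, hb, hba, hbu⟩ := h'
  obtain ⟨-, y', u', b', hy', hyu', huz', hb', hba', hbu'⟩ := hz'
  have hFu : F u u' := F.trans' (F.symm' hyu) (F.trans' (hy.unique hEFK hy').1 hyu')
  have hKu : K u u' := K.trans' huz (K.trans' hKz (K.symm' huz'))
  have hEb : E b b' := E.trans' hbu (E.trans' (hEFK.left hFu hKu) (E.symm' hbu'))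
  have hKb : K b b' := hEFK.right hEb (F.trans' (F.symm' hb) hb')
  exact hne' (K.trans' (K.symm' hba) (K.trans' hKb hba'))

theorem Word.eq_of_common (hE : S.Definable E) (hF : S.Definable F) (hK : S.Definable K)
    (hEFK : PairwiseInfEq E F K) (ha : S.Indiscernible a)
    (hne : ¬ K (a 0) (a 1)) {w w' : List ℕ} (hw : w.Pairwise (· > ·)) (hw' : w'.Pairwise (· > ·))
    {z : Γ} (h : Word E F K a w z) (h' : Word E F K a w' z) : w = w' := by
  induction w generalizing w' z with
  | nil =>
    cases w' with
    | nil => rfl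
    | cons t w' =>
      exact absurd h' (h.not_cons_of_lt hE hF hK hEFK ha hne (by simp) (List.pairwise_cons.1 hw').1)
  | cons s w ih =>
    rw [List.pairwise_cons] at hw
    cases w' with
    | nil => exact absurd h (h'.not_cons_of_lt hE hF hK hEFK ha hne (by simp) hw.1)
    | cons t w' =>
      rw [List.pairwise_cons] at hw'
      rcases lt_trichotomy s t with hst | rfl | hst
      · refine absurd h' (h.not_cons_of_lt hE hF hK hEFK ha hne (fun i hi => ?_) hw'.1)
        rcases List.mem_cons.1 hi with rfl | hi
        exacts [hst, (hw.1 i hi).trans hst]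
      · obtain ⟨y, hy, hy'⟩ := h.exists_of_cons hEFK h'
        rw [ih hw.2 hw'.2 hy hy']
      · refine absurd h (h'.not_cons_of_lt hE hF hK hEFK ha hne (fun i hi => ?_) hw.1)
        rcases List.mem_cons.1 hi with rfl | hi
        exacts [hst, (hw'.1 i hi).trans hst]

theorem Homogeneous.exists_word [NeZero n] (hhom : S.Homogeneous) (hE : S.Definable E)
    (hF : S.Definable F) (hK : S.Definable K) (hEa : ∀ i, E (a 0) (a i))
    (hb : ∀ i, ∃ b, F (a 0) b ∧ K b (a (i + 1))) (w : List ℕ) : ∃ z, Word E F K a w z := by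
  induction w with
  | nil => exact ⟨a 0, E.refl' _, F.refl' _, K.refl' _⟩
  | cons i w ih =>
    obtain ⟨y, hy⟩ := ih
    obtain ⟨b, hb, hba⟩ := hb i
    obtain ⟨u, hyu, hub⟩ := hhom.permute hE hF (E.symm' hy.rel) hb
    obtain ⟨z, huz, hza⟩ := hhom.permute hE hK hub hba
    exact ⟨z, E.trans' (hEa (i + 1)) (E.symm' hza), y, u, b, hy, hyu, huz, hb, hba, E.symm' hub⟩

end Word

open Classical in
/-- The position of a point over finitely many points `a 0, …, a N`: in each order, how many of
these points lie below it and how many lie above it. -/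
noncomputable def cut (S : PermStruct n Γ) (a : ℕ → Γ) (N : ℕ) (z : Γ) :
    Fin n → Fin (N + 2) × Fin (N + 2) := fun i =>
  (⟨((Finset.range (N + 1)).filter fun j => S.le i (a j) z).card,
    Nat.lt_succ_of_le ((Finset.card_filter_le _ _).trans_eq (Finset.card_range _))⟩,
   ⟨((Finset.range (N + 1)).filter fun j => S.le i z (a j)).card,
    Nat.lt_succ_of_le ((Finset.card_filter_le _ _).trans_eq (Finset.card_range _))⟩)

theorem le_iff_of_cut_eq {a : ℕ → Γ} {N : ℕ} {z z' : Γ} (h : S.cut a N z = S.cut a N z')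
    (i : Fin n) {j : ℕ} (hj : j ≤ N) :
    (S.le i (a j) z ↔ S.le i (a j) z') ∧ (S.le i z (a j) ↔ S.le i z' (a j)) := by
  classical
  have hj' : j ∈ Finset.range (N + 1) := Finset.mem_range.2 (Nat.lt_succ_of_le hj)
  have filter_iff : ∀ {p q : ℕ → Prop}, (∀ k, p k → q k) →
      ((Finset.range (N + 1)).filter p).card = ((Finset.range (N + 1)).filter q).card →
      (p j ↔ q j) := fun {p q} hpq hcard => by
    have := Finset.eq_of_subset_of_card_le (Finset.monotone_filter_right _ fun k _ => hpq k) hcard.ge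
    simpa [hj'] using Finset.ext_iff.1 this j
  have h₁ := congrArg Fin.val (congrArg Prod.fst (congrFun h i))
  have h₂ := congrArg Fin.val (congrArg Prod.snd (congrFun h i))
  rcases S.total i z z' with hz | hz
  · exact ⟨filter_iff (fun k hk => S.trans i _ _ _ hk hz) h₁,
      (filter_iff (fun k hk => S.trans i _ _ _ hz hk) h₂.symm).symm⟩
  · exact ⟨(filter_iff (fun k hk => S.trans i _ _ _ hk hz) h₁.symm).symm,
      filter_iff (fun k hk => S.trans i _ _ _ hz hk) h₂⟩

/-- Three definable equivalence relations with pairwise equal meets, one of them lying below the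
join of the others, are never in diamond position: otherwise the words over an indiscernible
sequence of length `N` would realize `2 ^ N` types, more than there are cuts. -/
theorem Homogeneous.le_of_pairwiseInfEq [NeZero n] (hhom : S.Homogeneous) {E F K : Setoid Γ}
    (hE : S.Definable E) (hF : S.Definable F) (hK : S.Definable K) (hEFK : PairwiseInfEq E F K)
    (hle : E ≤ F ⊔ K) : E ≤ K := by
  intro x y hxy
  by_contra hne
  obtain ⟨σ, hσ, rfl⟩ := hhom.exists_auto_apply_eq x y
  have hx : σ x ≠ x := fun h => hne (h.symm ▸ K.refl' x)
  obtain ⟨a, rfl, ha1, ha⟩ : ∃ a : ℕ → Γ, a 0 = x ∧ a 1 = σ x ∧ S.Indiscernible a :=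
    ⟨_, rfl, rfl, hhom.indiscernible_iterate hσ hx⟩
  rw [← ha1] at hxy hne
  have hshift : ∀ i, ∃ τ : Equiv.Perm Γ, S.IsAuto τ ∧ τ (a 0) = a 0 ∧ τ (a 1) = a (i + 1) := by
    intro i
    obtain ⟨τ, hτ, h⟩ := ha (fun j => j * (i + 1)) (strictMono_mul_right_of_pos i.succ_pos) 1
    exact ⟨τ, hτ, by simpa using h 0 zero_le_one, by simpa using h 1 le_rfl⟩
  have hEa : ∀ i, E (a 0) (a i) := by
    rintro (_ | i)
    · exact E.refl' _
    · obtain ⟨τ, hτ, h0, h1⟩ := hshift i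
      simpa [h0, h1] using (hE τ hτ _ _).1 hxy
  have hb : ∀ i, ∃ b, F (a 0) b ∧ K b (a (i + 1)) := by
    intro i
    obtain ⟨τ, hτ, h0, h1⟩ := hshift i
    have := (hF.comp hK τ hτ _ _).1 ((hhom.sup_iff hF hK).1 (hle hxy))
    rwa [h0, h1] at this
  choose z hz using hhom.exists_word hE hF hK hEa hb
  obtain ⟨N, hN⟩ := Nat.exists_sq_pow_lt_two_pow n
  obtain ⟨s, hs, t, ht, hst, hcut⟩ := Finset.exists_ne_map_eq_of_card_lt_of_maps_to
    (s := (Finset.range N).powerset)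
    (t := (Finset.univ : Finset (Fin n → Fin (N + 2) × Fin (N + 2))))
    (f := fun s => S.cut a N (z (s.sort (· ≥ ·))))
    (by simpa [sq] using hN) (fun _ _ => Finset.mem_univ _)
  refine hst ?_
  classical
  obtain ⟨τ, hτ, hfix, hτz⟩ := hhom.exists_auto_fixing ((Finset.range (N + 1)).image a)
    (z := z (s.sort (· ≥ ·))) (z' := z (t.sort (· ≥ ·))) (by
      simp only [Finset.forall_mem_image, Finset.mem_range]
      exact fun j hj i => le_iff_of_cut_eq hcut i (Nat.le_of_lt_succ hj))
  simp only [Finset.forall_mem_image, Finset.mem_range] at hfix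
  have hword : Word E F K a (s.sort (· ≥ ·)) (z (t.sort (· ≥ ·))) := by
    have := (hz (s.sort (· ≥ ·))).map hE hF hK hτ (hfix N.succ_pos) id fun i hi => hfix <| by
      have := Finset.mem_range.1 (Finset.mem_powerset.1 hs ((Finset.mem_sort _).1 hi))
      omega
    rwa [List.map_id, hτz] at this
  have heq := hword.eq_of_common hE hF hK hEFK ha hne (Finset.sortedGT_sort s).pairwise
    (Finset.sortedGT_sort t).pairwise (hz (t.sort (· ≥ ·)))
  rw [← Finset.sort_toFinset s (· ≥ ·), heq, Finset.sort_toFinset]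

theorem Homogeneous.inf_sup_le [NeZero n] (hhom : S.Homogeneous) {E F K : Setoid Γ}
    (hE : S.Definable E) (hF : S.Definable F) (hK : S.Definable K) :
    E ⊓ (F ⊔ K) ≤ (E ⊓ F) ⊔ (E ⊓ K) := by
  by_contra h
  obtain ⟨⟨E', hE'⟩, ⟨F', hF'⟩, ⟨K', hK'⟩, h₁, h₂, h₃, h₄⟩ :=
    IsModularLattice.exists_inf_eq_of_not_distrib
      (a := (⟨E, hE⟩ : hhom.definableLattice)) (b := ⟨F, hF⟩) (c := ⟨K, hK⟩) h
  have h₁' : E' ⊓ F' = F' ⊓ K' := congrArg Subtype.val h₁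
  have h₂' : E' ⊓ K' = F' ⊓ K' := congrArg Subtype.val h₂
  have h₃' : E' ≤ F' ⊔ K' := h₃
  have hinf : PairwiseInfEq E' F' K' :=
    { left := fun hx hy => (h₁'.ge ⟨hx, hy⟩).1
      middle := fun hx hy => (h₂'.le ⟨hx, hy⟩).1
      right := fun hx hy => (h₁'.le ⟨hx, hy⟩).2 }
  have hle := hhom.le_of_pairwiseInfEq hE' hF' hK' hinf h₃'
  exact h₄ fun x y hxy => hinf.middle hxy (hle hxy)

/-- Two pairs of points with the same order relations satisfy the same definable relations. -/
theorem Homogeneous.rel_iff_of_le_iff [NeZero n] (hhom : S.Homogeneous) {R : Γ → Γ → Prop}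
    (hR : S.Definable R) {x y x' y' : Γ}
    (h : ∀ i, (S.le i x y ↔ S.le i x' y') ∧ (S.le i y x ↔ S.le i y' x')) :
    R x y ↔ R x' y' := by
  obtain ⟨σ, hσ, rfl⟩ := hhom.exists_auto_apply_eq x x'
  obtain ⟨τ, hτ, hτx, hτy⟩ := hhom.exists_auto_fixing {σ x} (z := σ y) (z' := y') (by
    simpa [← hσ _ x y, ← hσ _ y x] using h)
  rw [hR σ hσ, hR τ hτ, hτx _ (Finset.mem_singleton_self _), hτy]

theorem Homogeneous.finite_definable [NeZero n] (hhom : S.Homogeneous) :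
    Finite {R : Setoid Γ // S.Definable R} := by
  let types : {R : Setoid Γ // S.Definable R} → Set (Fin n → Prop × Prop) := fun R =>
    {v | ∃ x y, R.1 x y ∧ v = fun i => (S.le i x y, S.le i y x)}
  have hle : ∀ R T, types R = types T → R.1 ≤ T.1 := fun R T hRT x y hxy => by
    obtain ⟨x', y', hxy', h⟩ : (fun i => (S.le i x y, S.le i y x)) ∈ types T :=
      hRT ▸ ⟨x, y, hxy, rfl⟩
    refine (hhom.rel_iff_of_le_iff T.2 fun i => ?_).2 hxy'
    have := congrFun h i
    exact ⟨(congrArg Prod.fst this).to_iff, (congrArg Prod.snd this).to_iff⟩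
  exact Finite.of_injective types fun R T hRT =>
    Subtype.ext (le_antisymm (hle R T hRT) (hle T R hRT.symm))

/-- The group of automorphisms fixing the class of `y` for a definable equivalence relation. -/
def classStabilizer {E : Setoid Γ} (hE : S.Definable E) (y : Γ) : Subgroup (Equiv.Perm Γ) where
  carrier := {σ | S.IsAuto σ ∧ E y (σ y)}
  mul_mem' := fun {σ _} hσ hτ => ⟨hσ.1.mul hτ.1, E.trans' hσ.2 ((hE σ hσ.1 _ _).1 hτ.2)⟩
  one_mem' := ⟨.one, E.refl' y⟩
  inv_mem' := fun {σ} hσ => ⟨hσ.1.inv, (hE σ hσ.1 _ _).2 (by simpa using E.symm' hσ.2)⟩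

/-- A class of a definable equivalence relation `E` is not covered by finitely many classes of
definable equivalence relations that do not contain `E`. -/
theorem Homogeneous.exists_rel_forall_not_rel [NeZero n] (hhom : S.Homogeneous) {E : Setoid Γ}
    (hE : S.Definable E) (y : Γ) {ι : Type*} [Finite ι] (c : ι → Γ) {F : ι → Setoid Γ}
    (hF : ∀ i, S.Definable (F i)) (hEF : ∀ i, ¬ E ≤ F i) :
    ∃ x, E y x ∧ ∀ i, ¬ F i (c i) x := by
  by_contra! hcover
  cases nonempty_fintype ι
  let H := classStabilizer hE y
  have hg : ∀ i, ∃ g : H, ∀ h : H, F i (c i) (h.1 y) → F i (c i) (g.1 y) := fun i => by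
    by_cases h : ∃ h : H, F i (c i) (h.1 y)
    · exact h.imp fun g hg _ _ => hg
    · exact ⟨1, fun h' hh' => absurd ⟨h', hh'⟩ h⟩
  choose g hg using hg
  obtain ⟨k, -, hk⟩ := Subgroup.exists_finiteIndex_of_leftCoset_cover (s := Finset.univ) (g := g)
    (H := fun i => (classStabilizer (hF i) y).subgroupOf H) (by
      refine Set.eq_univ_of_forall fun h => ?_
      obtain ⟨i, hi⟩ := hcover (h.1 y) h.2.2
      simp only [Finset.mem_univ, Set.iUnion_true, Set.mem_iUnion]
      refine ⟨i, Set.mem_smul_set_iff_inv_smul_mem.2 ⟨(g i)⁻¹.2.1.mul h.2.1, ?_⟩⟩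
      refine (hF i _ (g i).2.1 _ _).2 ?_
      simpa using (F i).trans' ((F i).symm' (hg i h hi)) hi)
  refine hEF k fun u v huv => ?_
  obtain ⟨σ, hσ, rfl⟩ := hhom.exists_auto_apply_eq y u
  obtain ⟨τ, hτ, hτy⟩ := hhom.exists_auto_apply_eq y (σ⁻¹ v)
  have hEτ : E y (τ y) := by
    rw [hτy]
    exact (hE σ hσ _ _).2 (by simpa using huv)
  obtain ⟨m, hm, -, hmem⟩ := Subgroup.exists_pow_mem_of_index_ne_zero hk.index_ne_zero
    (⟨τ, hτ, hEτ⟩ : H)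
  have hFm : F k y ((τ ^ m) y) := hmem.2
  rw [← Equiv.Perm.iterate_eq_pow, hhom.rel_iterate hτ (hF k) hm, hτy] at hFm
  simpa using (hF k σ hσ _ _).1 hFm

theorem Homogeneous.inf_sup_le_sup_inf [NeZero n] (hhom : S.Homogeneous) {F E K : Setoid Γ}
    (hF : S.Definable F) (hE : S.Definable E) (hK : S.Definable K) :
    (F ⊔ E) ⊓ (F ⊔ K) ≤ F ⊔ (E ⊓ K) := by
  have hFE := hhom.definable_sup hF hE
  refine (hhom.inf_sup_le hFE hF hK).trans (sup_le (inf_le_right.trans le_sup_left) ?_)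
  rw [inf_comm]
  refine (hhom.inf_sup_le hK hF hE).trans (sup_le (inf_le_right.trans le_sup_left) ?_)
  rw [inf_comm]
  exact le_sup_right

theorem Homogeneous.finset_inf_sup_le [NeZero n] (hhom : S.Homogeneous) {ι : Type*}
    {F : Setoid Γ} (hF : S.Definable F) {s : Finset ι} {E : ι → Setoid Γ}
    (hE : ∀ i ∈ s, S.Definable (E i)) : (s.inf fun i => F ⊔ E i) ≤ F ⊔ s.inf E := by
  classical
  induction s using Finset.induction_on with
  | empty => simp
  | insert i s _ ih =>
    rw [Finset.forall_mem_insert] at hE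
    rw [Finset.inf_insert, Finset.inf_insert]
    exact (inf_le_inf_left _ (ih hE.2)).trans
      (hhom.inf_sup_le_sup_inf hF hE.1 (Definable.finset_inf hE.2))

/-- The Chinese remainder theorem for definable equivalence relations. -/
theorem Homogeneous.exists_forall_rel [NeZero n] [Nonempty Γ] (hhom : S.Homogeneous) {s : Finset Γ}
    {E : Γ → Setoid Γ} (hE : ∀ a ∈ s, S.Definable (E a))
    (h : ∀ a ∈ s, ∀ b ∈ s, (E a ⊔ E b) a b) : ∃ x, ∀ a ∈ s, E a x a := by
  classical
  induction s using Finset.induction_on with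
  | empty => exact ⟨Classical.arbitrary Γ, by simp⟩
  | insert a s _ ih =>
    rw [Finset.forall_mem_insert] at hE
    obtain ⟨x, hx⟩ := ih hE.2 fun b hb c hc =>
      h b (Finset.mem_insert_of_mem hb) c (Finset.mem_insert_of_mem hc)
    have hax : (E a ⊔ s.inf E) a x := by
      refine hhom.finset_inf_sup_le hE.1 hE.2 ((Finset.inf_setoid_iff _ _ _ _).2 fun b hb => ?_)
      exact (E a ⊔ E b).trans' (h a (Finset.mem_insert_self _ _) b (Finset.mem_insert_of_mem hb))
        (le_sup_right (a := E a) (b := E b) ((E b).symm' (hx b hb)))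
    obtain ⟨z, haz, hzx⟩ := (hhom.sup_iff hE.1 (Definable.finset_inf hE.2)).1 hax
    rw [Finset.inf_setoid_iff] at hzx
    exact ⟨z, (Finset.forall_mem_insert _ _ _).2
      ⟨(E a).symm' haz, fun b hb => (E b).trans' (hzx b hb) (hx b hb)⟩⟩

/-- The distance `S.dmin x y`, bundled as an equivalence relation. -/
def dist (S : PermStruct n Γ) (x y : Γ) : Setoid Γ where
  r := S.dmin x y
  iseqv :=
    { refl := fun u _ _ hR _ => hR.refl u
      symm := fun h R hd hR hxy => hR.symm (h R hd hR hxy)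
      trans := fun h₁ h₂ R hd hR hxy => hR.trans (h₁ R hd hR hxy) (h₂ R hd hR hxy) }

theorem dist_rel (x y : Γ) : S.dist x y x y := fun _ _ _ h => h

theorem definable_dist (x y : Γ) : S.Definable (S.dist x y) := fun σ hσ u v =>
  forall₄_congr fun _ hd _ _ => hd σ hσ u v

theorem dist_le {R : Setoid Γ} (hR : S.Definable R) {x y : Γ} (h : R x y) : S.dist x y ≤ R :=
  fun _ _ huv => huv R hR R.iseqv h

theorem dist_comm (x y : Γ) : S.dist x y = S.dist y x :=
  le_antisymm (dist_le (definable_dist _ _) ((S.dist y x).symm' (dist_rel y x)))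
    (dist_le (definable_dist _ _) ((S.dist x y).symm' (dist_rel x y)))

theorem Homogeneous.exists_dist_eq_of_neZero [NeZero n] [Nonempty Γ] (hhom : S.Homogeneous)
    {A : Finset Γ} {E : Γ → Setoid Γ} (hE : ∀ a ∈ A, S.Definable (E a))
    (h₁ : ∀ a ∈ A, ∀ b ∈ A, E a ≤ E b ⊔ S.dist a b)
    (h₂ : ∀ a ∈ A, ∀ b ∈ A, S.dist a b ≤ E a ⊔ E b) : ∃ x, ∀ a ∈ A, S.dist x a = E a := by
  obtain ⟨y, hy⟩ := hhom.exists_forall_rel hE fun a ha b hb => h₂ a ha b hb (dist_rel a b)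
  have := hhom.finite_definable
  let J := A × {F : {F : Setoid Γ // S.Definable F} // ¬ A.inf E ≤ F.1}
  obtain ⟨x, hyx, hx⟩ := hhom.exists_rel_forall_not_rel (Definable.finset_inf hE) y
    (fun j : J => j.1.1) (F := fun j => j.2.1.1) (fun j => j.2.1.2) fun j => j.2.2
  rw [Finset.inf_setoid_iff] at hyx
  have hxE : ∀ a ∈ A, E a x a := fun a ha => (E a).trans' ((E a).symm' (hyx a ha)) (hy a ha)
  refine ⟨x, fun a ha => le_antisymm (dist_le (hE a ha) (hxE a ha)) ?_⟩
  have hd := definable_dist (S := S) x a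
  have hle : A.inf E ≤ S.dist x a := by
    by_contra hnle
    exact hx (⟨a, ha⟩, ⟨⟨_, hd⟩, hnle⟩) ((S.dist x a).symm' (dist_rel x a))
  have hab : ∀ b ∈ A, S.dist a b ≤ S.dist x a ⊔ E b := fun b hb =>
    dist_le (hhom.definable_sup hd (hE b hb)) <| (hhom.sup_iff hd (hE b hb)).2
      ⟨x, (S.dist x a).symm' (dist_rel x a), hxE b hb⟩
  calc E a ≤ A.inf fun b => S.dist x a ⊔ E b :=
        Finset.le_inf fun b hb => (h₁ a ha b hb).trans (sup_le le_sup_right (hab b hb))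
    _ ≤ S.dist x a ⊔ A.inf E := hhom.finset_inf_sup_le hd hE
    _ = S.dist x a := sup_eq_left.2 hle

/-- Without any orders, the only definable equivalence relations are the trivial ones. -/
theorem Definable.eq_top_of_rel {S : PermStruct 0 Γ} {E : Setoid Γ} (hE : S.Definable E) {x y : Γ}
    (hxy : x ≠ y) (h : E x y) : E = ⊤ := by
  classical
  have hx : ∀ u, E x u := fun u => by
    rcases eq_or_ne x u with rfl | hu
    · exact E.refl' x
    · simpa [Equiv.swap_apply_of_ne_of_ne hxy hu] using (hE (Equiv.swap y u) (·.elim0) x y).1 h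
  exact top_unique fun u v _ => E.trans' (E.symm' (hx u)) (hx v)

theorem exists_dist_eq_of_zero [Infinite Γ] {S : PermStruct 0 Γ}
    {A : Finset Γ} {E : Γ → Setoid Γ} (hE : ∀ a ∈ A, S.Definable (E a))
    (h₁ : ∀ a ∈ A, ∀ b ∈ A, E a ≤ E b ⊔ S.dist a b)
    (h₂ : ∀ a ∈ A, ∀ b ∈ A, S.dist a b ≤ E a ⊔ E b) : ∃ x, ∀ a ∈ A, S.dist x a = E a := by
  by_cases h : ∃ a ∈ A, E a = ⊥
  · obtain ⟨a, ha, hbot⟩ := h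
    refine ⟨a, fun b hb => le_antisymm ?_ ?_⟩
    · simpa [hbot] using h₂ a ha b hb
    · simpa [hbot, dist_comm b a] using h₁ b hb a ha
  · push Not at h
    obtain ⟨x, hx⟩ := Infinite.exists_notMem_finset A
    refine ⟨x, fun a ha => ?_⟩
    rw [(definable_dist x a).eq_top_of_rel (ne_of_mem_of_not_mem ha hx).symm (dist_rel x a)]
    obtain ⟨u, v, huv, hne⟩ : ∃ u v, E a u v ∧ u ≠ v := by
      by_contra! hall
      exact h a ha (bot_unique fun u v huv => hall u v huv)
    exact ((hE a ha).eq_top_of_rel hne huv).symm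

theorem Homogeneous.exists_dist_eq [Infinite Γ] (hhom : S.Homogeneous)
    {A : Finset Γ} {E : Γ → Setoid Γ} (hE : ∀ a ∈ A, S.Definable (E a))
    (h₁ : ∀ a ∈ A, ∀ b ∈ A, E a ≤ E b ⊔ S.dist a b)
    (h₂ : ∀ a ∈ A, ∀ b ∈ A, S.dist a b ≤ E a ⊔ E b) : ∃ x, ∀ a ∈ A, S.dist x a = E a := by
  cases n with
  | zero => exact exists_dist_eq_of_zero hE h₁ h₂
  | succ n => exact hhom.exists_dist_eq_of_neZero hE h₁ h₂

end PermStruct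

/-- The reduct of a homogeneous `n`-dimensional permutation structure to the language of
∅-definable equivalence relations is the generic `Λ`-ultrametric space: the one-point
extension property holds for distance assignments satisfying the `Λ`-triangle inequality,
where joins are joins of equivalence relations (transitive closures of unions). -/
theorem reduct_to_equivalence_relations_generic
    {n : ℕ} {Γ : Type*} [Countable Γ] [Infinite Γ] (S : PermStruct n Γ)
    (hhom : S.Homogeneous)
    (A : Finset Γ) (f : Γ → (Γ → Γ → Prop))
    (hf : ∀ a ∈ A, S.Definable (f a) ∧ Equivalence (f a))
    (htri₁ : ∀ a ∈ A, ∀ b ∈ A, ∀ u v, f a u v →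
      Relation.TransGen (fun p q => f b p q ∨ S.dmin a b p q) u v)
    (htri₂ : ∀ a ∈ A, ∀ b ∈ A, ∀ u v, S.dmin a b u v →
      Relation.TransGen (fun p q => f a p q ∨ f b p q) u v) :
    ∃ x : Γ, ∀ a ∈ A, ∀ u v, S.dmin x a u v ↔ f a u v := by
  classical
  let E : Γ → Setoid Γ := fun a => if ha : a ∈ A then ⟨f a, (hf a ha).2⟩ else ⊤
  have hEf : ∀ a ∈ A, ∀ u v, E a u v ↔ f a u v := fun a ha u v => by
    have hEa : E a = ⟨f a, (hf a ha).2⟩ := dif_pos ha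
    exact hEa ▸ Iff.rfl
  obtain ⟨x, hx⟩ := hhom.exists_dist_eq (A := A) (E := E)
    (fun a ha σ hσ u v => (hEf a ha _ _).trans (((hf a ha).1 σ hσ u v).trans (hEf a ha _ _).symm))
    (fun a ha b hb u v huv => Setoid.sup_rel_of_transGen <|
      Relation.TransGen.mono (fun p q => Or.imp_left (hEf b hb p q).2) _ _
        (htri₁ a ha b hb u v ((hEf a ha u v).1 huv)))
    (fun a ha b hb u v huv => Setoid.sup_rel_of_transGen <|
      Relation.TransGen.mono (fun p q => Or.imp (hEf a ha p q).2 (hEf b hb p q).2) _ _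
        (htri₂ a ha b hb u v huv))
  exact ⟨x, fun a ha u v => by rw [← hEf a ha, ← hx a ha]; rfl⟩
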